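/- Let E be a row-finite directed graph with no sources, and let Ê = (E^∞, E^∞, id, σ) be the associated topological graph. Let {q_v : v ∈ E⁰}, {t_e : e ∈ E¹} be a Cuntz–Krieger E-family in a C*-algebra B. Then there is a unique covariant Toeplitz representation (ψ, π) of Ê in B such that ψ(χ_{Z(eμ)}) = t_{eμ} t_μ* for every e ∈ E¹ and every μ ∈ E* with r(μ) = s(e), and π(χ_{Z(μ)}) = t_μ t_μ* for every μ ∈ E* (χ denotes the characteristic function; each Z(μ) is compact open, so these lie in the appropriate function spaces). -/

import Mathlib

open scoped ZeroAtInfty CompactlySupported ComplexOrder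

noncomputable section

namespace TopGraphPaper

variable {V G : Type*} [TopologicalSpace V] [TopologicalSpace G]

/-- The set `E⁰_fin` of vertices having a neighbourhood `N` with `r⁻¹(N)` compact. -/
def Efin (r : G → V) : Set V := {v | ∃ N ∈ nhds v, IsCompact (r ⁻¹' N)}

/-- The set `E⁰_sce = E⁰ \ closure (r(E¹))`. -/
def Esce (r : G → V) : Set V := (closure (Set.range r))ᶜ

/-- The set `E⁰_rg = E⁰_fin \ closure (E⁰_sce)`. -/
def Erg (r : G → V) : Set V := Efin r \ closure (Esce r)

/-- `U ⊆ E¹` is an `s`-section if `s` restricted to `U` is a homeomorphism onto its image. -/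
def IsSSection (s : G → V) (U : Set G) : Prop := Topology.IsEmbedding (U.restrict s)

/-- A complex-valued function is nonnegative if all its values are nonnegative reals. -/
def NonnegFn {α : Type*} (x : α → ℂ) : Prop := ∀ a, 0 ≤ x a

/-- The norm `‖x‖_{C₀(E⁰)} = sup_v √(Σ_{s e = v} |x e|²)` on `C_c(E¹)`. -/
def gnorm (s : G → V) (x : G → ℂ) : ℝ :=
  ⨆ v : V, Real.sqrt (∑' e : (s ⁻¹' {v} : Set G), ‖x (e : G)‖ ^ 2)

variable {B : Type*} [NonUnitalCStarAlgebra B]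

/-- A Toeplitz representation of the topological graph `(V, G, r, s)` in the C*-algebra `B`. -/
structure IsToeplitzRep (r s : G → V) (ψ : C_c(G, ℂ) →ₗ[ℂ] B)
    (π : C₀(V, ℂ) →⋆ₙₐ[ℂ] B) : Prop where
  act : ∀ (f : C₀(V, ℂ)) (x y : C_c(G, ℂ)), (∀ e, y e = f (r e) * x e) → ψ y = π f * ψ x
  inner : ∀ (x : C_c(G, ℂ)) (U : Set G), IsOpen U → IsSSection s U → tsupport ⇑x ⊆ U →
    ∀ g : C₀(V, ℂ), (∀ e, x e ≠ 0 → g (s e) = (‖x e‖ : ℂ) ^ 2) →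
      (∀ v, v ∉ s '' Function.support ⇑x → g v = 0) → π g = star (ψ x) * ψ x
  orth : ∀ (x y : C_c(G, ℂ)) (Ux Uy : Set G), IsOpen Ux → IsOpen Uy →
    IsSSection s Ux → IsSSection s Uy → Disjoint Ux Uy →
    tsupport ⇑x ⊆ Ux → tsupport ⇑y ⊆ Uy → star (ψ x) * ψ y = 0

/-- Covariance of a Toeplitz representation.  Here, for each `f` in the generating family `𝒢`,
the function `gN N` plays the role of `√(f_N)`, so that `f_N = (gN N)^2`. -/
def IsCovariant (r s : G → V) (ψ : C_c(G, ℂ) →ₗ[ℂ] B) (π : C₀(V, ℂ) →⋆ₙₐ[ℂ] B) : Prop :=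
  ∃ 𝒢 : Set C₀(V, ℂ),
    (∀ f ∈ 𝒢, HasCompactSupport ⇑f ∧ NonnegFn ⇑f ∧ tsupport ⇑f ⊆ Erg r) ∧
    closure ((NonUnitalStarAlgebra.adjoin ℂ 𝒢 : NonUnitalStarSubalgebra ℂ C₀(V, ℂ)) :
        Set C₀(V, ℂ)) = {f : C₀(V, ℂ) | ∀ v ∉ Erg r, f v = 0} ∧
    ∀ f ∈ 𝒢, ∃ (𝒩 : Finset (Set G)) (gN : Set G → C_c(G, ℂ)),
      (∀ N ∈ 𝒩, IsOpen N ∧ IsSSection s N) ∧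
      r ⁻¹' tsupport ⇑f ⊆ ⋃ N ∈ 𝒩, N ∧
      (∀ N ∈ 𝒩, NonnegFn ⇑(gN N) ∧
        Function.support ⇑(gN N) ⊆ N ∩ r ⁻¹' tsupport ⇑f) ∧
      (∀ e, ∑ N ∈ 𝒩, (gN N e) ^ 2 = f (r e)) ∧
      π f = ∑ N ∈ 𝒩, ψ (gN N) * star (ψ (gN N))

/-- A local `r`-fibration `(𝒰, W)`. -/
structure IsLocalRFib (r s : G → V) (𝒰 : Finset (Set G)) (W : Set V) : Prop where
  disj : (𝒰 : Set (Set G)).Pairwise Disjoint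
  sSec : ∀ U ∈ 𝒰, IsSSection s U
  rSec : ∀ U ∈ 𝒰, IsSSection r U
  pre : r ⁻¹' W = ⋃ U ∈ 𝒰, U
  ran : ∀ U ∈ 𝒰, r '' U = W

/-- An open local `r`-fibration. -/
def IsOpenLocalRFib (r s : G → V) (𝒰 : Finset (Set G)) (W : Set V) : Prop :=
  IsLocalRFib r s 𝒰 W ∧ IsOpen W ∧ ∀ U ∈ 𝒰, IsOpen U

/-- A precompact local `r`-fibration. -/
def IsPrecompactLocalRFib (r s : G → V) (𝒰 : Finset (Set G)) (W : Set V) : Prop :=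
  IsLocalRFib r s 𝒰 W ∧ IsCompact (closure W) ∧ ∀ U ∈ 𝒰, IsCompact (closure U)


variable {V G : Type*} [TopologicalSpace V] [TopologicalSpace G]

/-- The space `Eⁿ` of paths of length `n`, as a subset of `(E¹)ⁿ`. -/
def PathSet (r s : G → V) (n : ℕ) : Set (Fin n → G) :=
  {μ | ∀ (i : ℕ) (h : i + 1 < n), s (μ ⟨i, by omega⟩) = r (μ ⟨i + 1, h⟩)}

/-- The function `x₁ ◇ ⋯ ◇ xₙ` on `(E¹)ⁿ`. -/
def diam {n : ℕ} (x : Fin n → C_c(G, ℂ)) (μ : Fin n → G) : ℂ := ∏ i, x i (μ i)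

/-- `lprod a [b₁,…,bₖ] = a * b₁ * ⋯ * bₖ` (products in a possibly non-unital ring). -/
def lprod {M : Type*} [Mul M] : M → List M → M
  | a, [] => a
  | a, b :: l => lprod (a * b) l

/-- The product `F 0 * F 1 * ⋯ * F (n-1)` for `n ≥ 1`. -/
def finProd {M : Type*} [Mul M] {n : ℕ} (hn : 0 < n) (F : Fin n → M) : M :=
  lprod (F ⟨0, hn⟩) (List.ofFn fun i : Fin (n - 1) => F ⟨(i : ℕ) + 1, by omega⟩)

/-- The infinite path space `E^∞`. -/
def InfPath (r s : G → V) : Type _ := {z : ℕ → G // ∀ i, s (z i) = r (z (i + 1))}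

instance (r s : G → V) : TopologicalSpace (InfPath r s) :=
  inferInstanceAs (TopologicalSpace {z : ℕ → G // ∀ i, s (z i) = r (z (i + 1))})

/-- The shift map `σ : E^∞ → E^∞`. -/
def shift (r s : G → V) : InfPath r s → InfPath r s :=
  fun z => ⟨fun i => z.1 (i + 1), fun i => z.2 (i + 1)⟩

/-- A list of edges is a (finite) path when consecutive edges compose. -/
def IsPathL (r s : G → V) (μ : List G) : Prop := μ.Chain' fun e f => s e = r f

/-- The cylinder set `Z(μ)` of a finite path `μ` of positive length. -/
def cylP (r s : G → V) (μ : List G) : Set (InfPath r s) :=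
  {z | ∀ (i : ℕ) (h : i < μ.length), z.1 i = μ.get ⟨i, h⟩}

/-- The cylinder set `Z(v)` of a vertex `v`. -/
def cylV (r s : G → V) (v : V) : Set (InfPath r s) := {z | r (z.1 0) = v}

/-- `t_μ`, with the convention `t_v = q_v` for paths `μ` of length zero based at `v`. -/
def tPath {M : Type*} [Mul M] (Q : V → M) (T : G → M) (v : V) : List G → M
  | [] => Q v
  | e :: l => lprod (T e) (l.map T)

variable {B : Type*} [NonUnitalCStarAlgebra B]

/-- A Cuntz–Krieger `E`-family in `B`. -/
structure IsCKFamily (r s : G → V) (Q : V → B) (T : G → B) : Prop where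
  proj : ∀ v, star (Q v) = Q v ∧ Q v * Q v = Q v
  orth : ∀ v w, v ≠ w → Q v * Q w = 0
  srce : ∀ e, star (T e) * T e = Q (s e)
  ck : ∀ (v : V) (F : Finset G), (∀ e, e ∈ F ↔ r e = v) → Q v = ∑ e ∈ F, T e * star (T e)

section CuntzKrieger

variable {V G B : Type*} [NonUnitalCStarAlgebra B] {r s : G → V} {Q : V → B} {T : G → B}

lemma IsCKFamily.mul_source (h : IsCKFamily r s Q T) (e : G) : T e * Q (s e) = T e := by
  rw [← sub_eq_zero, ← CStarRing.star_mul_self_eq_zero_iff]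
  have h1 := h.srce e
  have h2 := (h.proj (s e)).1
  have h3 := (h.proj (s e)).2
  have h4 : Q (s e) * star (T e) * T e = Q (s e) := by rw [mul_assoc, h1, h3]
  simp only [star_sub, star_mul, h2, sub_mul, mul_sub, ← mul_assoc, h4, h1, h3]
  simp

lemma IsCKFamily.source_mul_star (h : IsCKFamily r s Q T) (e : G) :
    Q (s e) * star (T e) = star (T e) := by
  have := congrArg star (h.mul_source e)
  rwa [star_mul, (h.proj (s e)).1] at this

lemma mul_star_eq_zero_of_sum_eq_zero {ι : Type*} {F : Finset ι} {a : ι → B}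
    (h : ∑ i ∈ F, a i * star (a i) = 0) {i : ι} (hi : i ∈ F) : a i = 0 := by
  let _ := CStarAlgebra.spectralOrder B
  have := CStarAlgebra.spectralOrderedRing B
  rw [Finset.sum_eq_zero_iff_of_nonneg fun i _ => mul_star_self_nonneg (a i)] at h
  exact (CStarRing.mul_star_self_eq_zero_iff _).1 (h i hi)

variable (hrow : ∀ v : V, (r ⁻¹' {v}).Finite)
include hrow

lemma IsCKFamily.vertex_eq_sum (h : IsCKFamily r s Q T) (v : V) :
    Q v = ∑ e ∈ (hrow v).toFinset, T e * star (T e) :=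
  h.ck v _ fun e => by simp

lemma IsCKFamily.range_mul (h : IsCKFamily r s Q T) (e : G) : Q (r e) * T e = T e := by
  rw [← sub_eq_zero]
  refine mul_star_eq_zero_of_sum_eq_zero (F := (hrow (r e)).toFinset)
    (a := fun f => Q (r e) * T f - T f) ?_ (by simp)
  have h2 := (h.proj (r e)).1
  have h3 := (h.proj (r e)).2
  have key : ∀ f, (Q (r e) * T f - T f) * star (Q (r e) * T f - T f) =
      Q (r e) * (T f * star (T f)) * Q (r e) - Q (r e) * (T f * star (T f))
        - (T f * star (T f)) * Q (r e) + T f * star (T f) := fun f => by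
    simp only [star_sub, star_mul, h2]
    noncomm_ring
  simp only [key, Finset.sum_add_distrib, Finset.sum_sub_distrib, ← Finset.mul_sum,
    ← Finset.sum_mul, ← h.vertex_eq_sum hrow, h3]
  simp

lemma IsCKFamily.star_mul_of_ne (h : IsCKFamily r s Q T) {e f : G} (hef : e ≠ f) :
    star (T e) * T f = 0 := by
  classical
  by_cases hr : r f = r e
  · refine mul_star_eq_zero_of_sum_eq_zero (F := (hrow (r e)).toFinset.erase e)
      (a := fun f => star (T e) * T f) ?_ (by simp [hr, hef.symm])
    have h1 : star (T e) * Q (r e) * T e = star (T e) * T e := by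
      rw [mul_assoc, h.range_mul hrow]
    rw [h.vertex_eq_sum hrow (r e),
      ← Finset.add_sum_erase _ _ (show e ∈ (hrow (r e)).toFinset by simp), mul_add, add_mul,
      ← mul_assoc, h.srce, mul_assoc, h.srce, (h.proj _).2, add_eq_left, Finset.mul_sum,
      Finset.sum_mul] at h1
    simpa [mul_assoc] using h1
  · rw [← h.range_mul hrow e, ← h.range_mul hrow f, star_mul, (h.proj _).1, mul_assoc,
      ← mul_assoc (Q _), h.orth _ _ (Ne.symm hr), zero_mul, mul_zero]

end CuntzKrieger

section PathSpace

variable {V G : Type*} {r s : G → V}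

/-- The infinite path `ew` obtained by prefixing an edge `e` to an infinite path `w`. -/
def InfPath.cons (e : G) (w : InfPath r s) (h : s e = r (w.1 0)) : InfPath r s :=
  ⟨fun n => Nat.casesOn n e w.1, fun n => by cases n with
    | zero => exact h
    | succ n => exact w.2 n⟩

@[simp] lemma InfPath.cons_zero (e : G) (w : InfPath r s) (h : s e = r (w.1 0)) :
    (InfPath.cons e w h).1 0 = e := rfl

@[simp] lemma shift_cons (e : G) (w : InfPath r s) (h : s e = r (w.1 0)) :
    shift r s (InfPath.cons e w h) = w := rfl

lemma InfPath.cons_shift (z : InfPath r s) :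
    InfPath.cons (z.1 0) (shift r s z) (z.2 0) = z :=
  Subtype.ext (funext fun n => by cases n <;> rfl)

/-- The function `w ↦ f (ew)`, extended by zero to the paths `w` with `r w ≠ s e`. -/
def pullFun (e : G) (f : InfPath r s → ℂ) (w : InfPath r s) : ℂ :=
  open Classical in if h : s e = r (w.1 0) then f (InfPath.cons e w h) else 0

lemma pullFun_of_eq {e : G} {f : InfPath r s → ℂ} {w : InfPath r s} (h : s e = r (w.1 0)) :
    pullFun e f w = f (InfPath.cons e w h) := dif_pos h

lemma pullFun_of_ne {e : G} {f : InfPath r s → ℂ} {w : InfPath r s} (h : s e ≠ r (w.1 0)) :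
    pullFun e f w = 0 := dif_neg h

lemma cylP_cons_subset (e : G) (μ : List G) : cylP r s (e :: μ) ⊆ cylV r s (r e) :=
  fun z hz => congrArg r (hz 0 (by simp))

lemma mem_cylP_cons {e : G} {μ : List G} {z : InfPath r s} :
    z ∈ cylP r s (e :: μ) ↔ z.1 0 = e ∧ shift r s z ∈ cylP r s μ := by
  constructor
  · exact fun h => ⟨h 0 (by simp), fun i hi => h (i + 1) (by simpa using hi)⟩
  · rintro ⟨h0, h⟩ i hi
    cases i with
    | zero => exact h0
    | succ i => exact h i (by simpa using hi)

lemma exists_mem_cylV (hsrc : ∀ v : V, (r ⁻¹' {v}).Nonempty) (v : V) :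
    (cylV r s v).Nonempty := by
  choose c hc using hsrc
  exact ⟨⟨fun n => c ((fun w => s (c w))^[n] v), fun n => by
    simp only [Function.iterate_succ_apply']
    exact (hc _).symm⟩, hc v⟩

variable [TopologicalSpace G]

instance [T2Space G] : T2Space (InfPath r s) :=
  inferInstanceAs (T2Space {z : ℕ → G // ∀ i, s (z i) = r (z (i + 1))})

lemma InfPath.continuous_apply (i : ℕ) : Continuous fun z : InfPath r s => z.1 i :=
  (_root_.continuous_apply i).comp continuous_subtype_val

lemma continuous_shift : Continuous (shift r s) :=
  Continuous.subtype_mk (continuous_pi fun i => InfPath.continuous_apply (i + 1)) _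

lemma tendsto_pullFun (e : G) {f : InfPath r s → ℂ}
    (hf : Filter.Tendsto f (Filter.cocompact _) (nhds 0)) :
    Filter.Tendsto (pullFun e f) (Filter.cocompact _) (nhds 0) := by
  intro U hU
  obtain ⟨K, hK, hKU⟩ := Filter.mem_cocompact.1 (hf hU)
  refine Filter.mem_cocompact.2 ⟨_, hK.image continuous_shift, fun w hw => ?_⟩
  by_cases h : s e = r (w.1 0)
  · rw [Set.mem_preimage, pullFun_of_eq h]
    exact hKU fun hmem => hw ⟨_, hmem, shift_cons e w h⟩
  · rw [Set.mem_preimage, pullFun_of_ne h]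
    exact mem_of_mem_nhds hU

variable [DiscreteTopology G]

lemma isClopen_head (S : Set G) : IsClopen {z : InfPath r s | z.1 0 ∈ S} :=
  (isClopen_discrete S).preimage (InfPath.continuous_apply 0)

lemma isClopen_cylV (v : V) : IsClopen (cylV r s v) := isClopen_head (r ⁻¹' {v})

lemma continuous_pullFun (e : G) {f : InfPath r s → ℂ} (hf : Continuous f) :
    Continuous (pullFun e f) := by
  have hc : IsClopen {w : InfPath r s | s e = r (w.1 0)} := isClopen_head {g | s e = r g}
  rw [← continuousOn_univ, ← Set.union_compl_self {w : InfPath r s | s e = r (w.1 0)}]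
  refine ContinuousOn.union_of_isOpen ?_ ?_ hc.isOpen hc.compl.isOpen
  · rw [continuousOn_iff_continuous_domRestrict]
    have : Continuous fun w : {w : InfPath r s | s e = r (w.1 0)} =>
        InfPath.cons e w.1 w.2 := by
      refine Continuous.subtype_mk (continuous_pi fun n => ?_) _
      cases n with
      | zero => exact continuous_const
      | succ n => exact (InfPath.continuous_apply n).comp continuous_subtype_val
    refine (hf.comp this).congr fun w => ?_
    exact (pullFun_of_eq w.2).symm
  · exact continuousOn_const.congr fun w hw => pullFun_of_ne hw

/-- The `*`-homomorphism `C₀(E^∞) → C₀(E^∞)` sending `f` to `w ↦ f (ew)`, extended by zero. -/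
def pull (r s : G → V) (e : G) : C₀(InfPath r s, ℂ) →⋆ₙₐ[ℂ] C₀(InfPath r s, ℂ) where
  toFun f := ⟨⟨pullFun e f, continuous_pullFun e f.continuous⟩, tendsto_pullFun e (zero_at_infty f)⟩
  map_smul' c f := by
    ext w
    change pullFun e _ w = c * pullFun e _ w
    by_cases h : s e = r (w.1 0) <;> simp [pullFun, h]
  map_zero' := by
    ext w
    change pullFun e _ w = 0
    by_cases h : s e = r (w.1 0) <;> simp [pullFun, h]
  map_add' f g := by
    ext w
    change pullFun e _ w = pullFun e _ w + pullFun e _ w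
    by_cases h : s e = r (w.1 0) <;> simp [pullFun, h]
  map_mul' f g := by
    ext w
    change pullFun e _ w = pullFun e _ w * pullFun e _ w
    by_cases h : s e = r (w.1 0) <;> simp [pullFun, h]
  map_star' f := by
    ext w
    change pullFun e _ w = star (pullFun e _ w)
    by_cases h : s e = r (w.1 0) <;> simp [pullFun, h]

lemma pull_apply_of_eq {e : G} (f : C₀(InfPath r s, ℂ)) {w : InfPath r s}
    (h : s e = r (w.1 0)) : pull r s e f w = f (InfPath.cons e w h) := pullFun_of_eq h

lemma pull_apply_of_ne {e : G} (f : C₀(InfPath r s, ℂ)) {w : InfPath r s}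
    (h : s e ≠ r (w.1 0)) : pull r s e f w = 0 := pullFun_of_ne h

lemma isClopen_cylP (μ : List G) : IsClopen (cylP r s μ) := by
  have : cylP r s μ = ⋂ i : Fin μ.length, {z | z.1 i ∈ ({μ.get i} : Set G)} := by
    ext z
    simp only [cylP, Set.mem_iInter, Set.mem_ofPred_eq, Set.mem_singleton_iff]
    exact ⟨fun h i => h i i.2, fun h i hi => h ⟨i, hi⟩⟩
  rw [this]
  exact isClopen_iInter_of_finite fun i =>
    (isClopen_discrete _).preimage (InfPath.continuous_apply (i : ℕ))

lemma isClosedEmbedding_val :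
    Topology.IsClosedEmbedding (Subtype.val : InfPath r s → (ℕ → G)) := by
  refine IsClosed.isClosedEmbedding_subtypeVal ?_
  have : {z : ℕ → G | ∀ i, s (z i) = r (z (i + 1))} =
      ⋂ i, (fun z : ℕ → G => (z i, z (i + 1))) ⁻¹' {p | s p.1 = r p.2} := by
    ext; simp
  change IsClosed {z : ℕ → G | ∀ i, s (z i) = r (z (i + 1))}
  rw [this]
  exact isClosed_iInter fun i => (isClosed_discrete _).preimage
    ((_root_.continuous_apply i).prodMk (_root_.continuous_apply (i + 1)))

lemma isCompact_cylV (hrow : ∀ v : V, (r ⁻¹' {v}).Finite) (v : V) :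
    IsCompact (cylV r s v) := by
  let F : ℕ → Set G := fun n => Nat.rec (r ⁻¹' {v}) (fun _ S => ⋃ e ∈ S, r ⁻¹' {s e}) n
  have hF : ∀ n, (F n).Finite := fun n => by
    induction n with
    | zero => exact hrow v
    | succ n ih => exact ih.biUnion fun e _ => hrow (s e)
  have hK := isClosedEmbedding_val.isCompact_preimage (f := (Subtype.val : InfPath r s → (ℕ → G)))
    (isCompact_univ_pi fun n => (hF n).isCompact)
  refine hK.of_isClosed_subset (isClopen_cylV v).isClosed fun z hz n _ => ?_
  induction n with
  | zero => exact hz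
  | succ n ih => exact Set.mem_biUnion (ih trivial) (z.2 n).symm

lemma isCompact_cylP (hrow : ∀ v : V, (r ⁻¹' {v}).Finite) (e : G) (μ : List G) :
    IsCompact (cylP r s (e :: μ)) :=
  (isCompact_cylV hrow (r e)).of_isClosed_subset (isClopen_cylP _).isClosed
    (cylP_cons_subset e μ)

lemma isSSection_of_subset {U : Set (InfPath r s)} {e : G} (hU : ∀ z ∈ U, z.1 0 = e) :
    IsSSection (shift r s) U := by
  let c : InfPath r s → (ℕ → G) := fun w n => Nat.casesOn n e w.1
  refine Topology.IsEmbedding.of_comp (g := c)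
    (continuous_shift.comp continuous_subtype_val) ?_ ?_
  · refine continuous_pi fun n => ?_
    cases n with
    | zero => exact continuous_const
    | succ n => exact InfPath.continuous_apply n
  · have : c ∘ U.domRestrict (shift r s) = Subtype.val ∘ Subtype.val := by
      funext z n
      cases n with
      | zero => exact (hU z.1 z.2).symm
      | succ n => rfl
    change Topology.IsEmbedding (c ∘ U.domRestrict (shift r s))
    rw [this]
    exact isClosedEmbedding_val.isEmbedding.comp Topology.IsEmbedding.subtypeVal

/-- The characteristic function of a compact open set, as an element of `C₀`. -/
def chi {X : Type*} [TopologicalSpace X] (U : Set X) (ho : IsClopen U) (hc : IsCompact U) :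
    C₀(X, ℂ) where
  toFun := U.indicator fun _ => 1
  continuous_toFun := continuous_const.indicator fun x hx => by simp [ho.frontier_eq] at hx
  zero_at_infty' := tendsto_const_nhds.congr' <| Filter.mem_cocompact.2
    ⟨U, hc, fun x hx => (Set.indicator_of_notMem hx _).symm⟩

lemma chi_of_mem {X : Type*} [TopologicalSpace X] {U : Set X} (ho : IsClopen U)
    (hc : IsCompact U) {x : X} (h : x ∈ U) : chi U ho hc x = 1 :=
  Set.indicator_of_mem h fun _ => (1 : ℂ)

lemma chi_of_notMem {X : Type*} [TopologicalSpace X] {U : Set X} (ho : IsClopen U)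
    (hc : IsCompact U) {x : X} (h : x ∉ U) : chi U ho hc x = 0 :=
  Set.indicator_of_notMem h fun _ => (1 : ℂ)

end PathSpace

section Density

variable {V G : Type*} {r s : G → V} [TopologicalSpace G] [DiscreteTopology G]

/-- The characteristic functions of the cylinder sets of paths of positive length. -/
def cylFns (r s : G → V) : Set C₀(InfPath r s, ℂ) :=
  {f | ∃ (e : G) (μ : List G), IsPathL r s (e :: μ) ∧
    ∀ z, f z = (cylP r s (e :: μ)).indicator (fun _ => (1 : ℂ)) z}

lemma exists_cylP_subset (z : InfPath r s) {U : Set (InfPath r s)} (hU : U ∈ nhds z) :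
    ∃ (e : G) (μ : List G), IsPathL r s (e :: μ) ∧ z ∈ cylP r s (e :: μ) ∧
      cylP r s (e :: μ) ⊆ U := by
  obtain ⟨W, hW, hWU⟩ := (isClosedEmbedding_val.isInducing.nhds_eq_comap z).ge hU
  rw [nhds_pi, Filter.mem_pi] at hW
  obtain ⟨I, hI, t, ht, htW⟩ := hW
  obtain ⟨N, hN⟩ := hI.bddAbove
  have hlist : (z.1 0 :: List.ofFn fun i : Fin N => z.1 (i + 1)) =
      List.ofFn fun i : Fin (N + 1) => z.1 i := by
    rw [List.ofFn_succ]
    rfl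
  refine ⟨z.1 0, List.ofFn fun i : Fin N => z.1 (i + 1), ?_, ?_, ?_⟩
  · rw [hlist]
    refine List.isChain_iff_getElem.2 fun i hi => ?_
    simpa only [List.getElem_ofFn] using z.2 i
  · rw [hlist]
    intro i hi
    simp only [List.get_eq_getElem, List.getElem_ofFn]
  · rw [hlist]
    refine fun w hw => hWU (htW fun i hi => ?_)
    have := hw i (by simpa using Nat.lt_succ_of_le (hN hi))
    simp only [List.get_eq_getElem, List.getElem_ofFn] at this
    rw [this]
    exact mem_of_mem_nhds (ht i)

/-- The characteristic functions of cylinder sets generate a dense subalgebra of `C₀(E^∞)`. -/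
lemma closure_adjoin_cylFns (hrow : ∀ v : V, (r ⁻¹' {v}).Finite) :
    closure ((NonUnitalStarAlgebra.adjoin ℂ (cylFns r s) :
      NonUnitalStarSubalgebra ℂ C₀(InfPath r s, ℂ)) : Set C₀(InfPath r s, ℂ)) = Set.univ := by
  set M := NonUnitalStarAlgebra.adjoin ℂ (cylFns r s)
  refine Set.eq_univ_of_forall fun f => Metric.mem_closure_iff.2 fun ε hε => ?_
  obtain ⟨K, hK, hKf⟩ := Filter.mem_cocompact.1
    (zero_at_infty f (Metric.ball_mem_nhds 0 (half_pos hε)))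
  have hlocal : ∃ u ∈ M, ∃ g ∈ M, ∃ U : Set (InfPath r s), K ⊆ U ∧
      (∀ z, u z = U.indicator (fun _ => (1 : ℂ)) z) ∧
      ∀ z, (z ∈ U → dist (f z) (g z) < ε / 2) ∧ (z ∉ U → g z = 0) := by
    refine hK.induction_on (p := fun K => ∃ u ∈ M, ∃ g ∈ M, ∃ U : Set (InfPath r s), K ⊆ U ∧
      (∀ z, u z = U.indicator (fun _ => (1 : ℂ)) z) ∧
      ∀ z, (z ∈ U → dist (f z) (g z) < ε / 2) ∧ (z ∉ U → g z = 0)) ?_ ?_ ?_ ?_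
    · exact ⟨0, zero_mem M, 0, zero_mem M, ∅, by simp⟩
    · rintro K₁ K₂ h ⟨u, hu, g, hg, U, hKU, h'⟩
      exact ⟨u, hu, g, hg, U, h.trans hKU, h'⟩
    · rintro K₁ K₂ ⟨u₁, hu₁, g₁, hg₁, U₁, hKU₁, hi₁, h₁⟩ ⟨u₂, hu₂, g₂, hg₂, U₂, hKU₂, hi₂, h₂⟩
      refine ⟨u₁ + (u₂ - u₂ * u₁), add_mem hu₁ (sub_mem hu₂ (mul_mem hu₂ hu₁)),
        g₁ + (g₂ - g₂ * u₁), add_mem hg₁ (sub_mem hg₂ (mul_mem hg₂ hu₁)), U₁ ∪ U₂,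
        Set.union_subset_union hKU₁ hKU₂, fun z => ?_, fun z => ?_⟩
      · by_cases hz₁ : z ∈ U₁ <;> by_cases hz₂ : z ∈ U₂ <;> simp [hi₁, hi₂, hz₁, hz₂]
      · have := h₁ z
        have := h₂ z
        by_cases hz₁ : z ∈ U₁ <;> by_cases hz₂ : z ∈ U₂ <;> simp_all
    · intro z _
      have hn : {w | dist (f w) (f z) < ε / 2} ∈ nhds z :=
        f.continuous.continuousAt (Metric.ball_mem_nhds _ (half_pos hε))
      obtain ⟨e, μ, hμ, hz, hsub⟩ := exists_cylP_subset z hn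
      let u := chi (cylP r s (e :: μ)) (isClopen_cylP _) (isCompact_cylP hrow e μ)
      have hu : u ∈ M := NonUnitalStarAlgebra.subset_adjoin ℂ _ ⟨e, μ, hμ, fun _ => rfl⟩
      refine ⟨_, mem_nhdsWithin_of_mem_nhds ((isClopen_cylP (e :: μ)).isOpen.mem_nhds hz),
        u, hu, f z • u, SMulMemClass.smul_mem _ hu, _, subset_rfl, fun _ => rfl, fun w => ⟨?_, ?_⟩⟩
      · intro hw
        simpa [u, chi_of_mem _ _ hw] using hsub hw
      · intro hw
        simp [u, chi_of_notMem _ _ hw]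
  obtain ⟨u, -, g, hg, U, hKU, -, hgU⟩ := hlocal
  refine ⟨g, hg, lt_of_le_of_lt ?_ (half_lt_self hε)⟩
  rw [← ZeroAtInftyContinuousMap.dist_toBCF_eq_dist,
    BoundedContinuousFunction.dist_le (half_pos hε).le]
  intro z
  change dist (f z) (g z) ≤ ε / 2
  by_cases hz : z ∈ U
  · exact ((hgU z).1 hz).le
  · rw [(hgU z).2 hz]
    exact (Metric.mem_ball.1 (hKf fun h => hz (hKU h))).le

end Density

section Limits

variable {A B ι : Type*} [NonUnitalCStarAlgebra A] [NonUnitalCStarAlgebra B] {l : Filter ι}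
  [l.NeBot]

lemma exists_tendsto_of_mem_closure (Φ : ι → A →⋆ₙₐ[ℂ] B) {S : Set A}
    (hS : ∀ a ∈ S, ∃ b, Filter.Tendsto (fun i => Φ i a) l (nhds b)) {a : A} (ha : a ∈ closure S) :
    ∃ b, Filter.Tendsto (fun i => Φ i a) l (nhds b) := by
  rw [← cauchy_map_iff_exists_tendsto]
  refine Metric.cauchy_iff.2 ⟨inferInstance, fun ε hε => ?_⟩
  obtain ⟨a', ha', hd⟩ := Metric.mem_closure_iff.1 ha (ε / 4) (by positivity)
  obtain ⟨b, hb⟩ := hS a' ha'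
  refine ⟨Metric.ball b (ε / 2), ?_, fun x hx y hy => ?_⟩
  · have hev := hb (Metric.ball_mem_nhds b (show 0 < ε / 4 by positivity))
    rw [Filter.mem_map] at hev ⊢
    filter_upwards [hev] with i hi
    have h1 : dist (Φ i a) (Φ i a') ≤ dist a a' := by
      rw [dist_eq_norm, dist_eq_norm, ← map_sub]
      exact NonUnitalStarAlgHom.norm_apply_le (Φ i) _
    have h2 : dist (Φ i a') b < ε / 4 := hi
    have := dist_triangle (Φ i a) (Φ i a') b
    change dist (Φ i a) b < ε / 2
    linarith
  · have := dist_triangle_right x y b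
    rw [Metric.mem_ball] at hx hy
    linarith

/-- A pointwise convergent net of `*`-homomorphisms converges to a `*`-homomorphism. -/
lemma exists_limit_starHom (Φ : ι → A →⋆ₙₐ[ℂ] B)
    (h : ∀ a, ∃ b, Filter.Tendsto (fun i => Φ i a) l (nhds b)) :
    ∃ π : A →⋆ₙₐ[ℂ] B, ∀ a, Filter.Tendsto (fun i => Φ i a) l (nhds (π a)) := by
  choose p hp using h
  exact ⟨{
    toFun := p
    map_smul' := fun c a => tendsto_nhds_unique (hp _) (by simpa using (hp a).const_smul c)
    map_zero' := tendsto_nhds_unique (hp _) (by simp)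
    map_add' := fun a b => tendsto_nhds_unique (hp _) (by simpa using (hp a).add (hp b))
    map_mul' := fun a b => tendsto_nhds_unique (hp _) (by simpa using (hp a).mul (hp b))
    map_star' := fun a => tendsto_nhds_unique (hp _) (by simpa [map_star] using (hp a).star) }, hp⟩

lemma starHom_ext_of_closure_adjoin {S : Set A}
    (hS : closure ((NonUnitalStarAlgebra.adjoin ℂ S : NonUnitalStarSubalgebra ℂ A) : Set A) =
      Set.univ) {φ ψ : A →⋆ₙₐ[ℂ] B} (h : ∀ a ∈ S, φ a = ψ a) : φ = ψ := by
  have hc : ∀ φ : A →⋆ₙₐ[ℂ] B, Continuous φ := fun φ =>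
    AddMonoidHomClass.continuous_of_bound φ 1 fun a => by
      simpa using NonUnitalStarAlgHom.norm_apply_le φ a
  refine DFunLike.coe_injective (Continuous.ext_on (dense_iff_closure_eq.2 hS) (hc φ) (hc ψ) ?_)
  intro a ha
  induction ha using NonUnitalStarAlgebra.adjoin_induction with
  | mem a ha => exact h a ha
  | add a b _ _ ha hb => rw [map_add, map_add, ha, hb]
  | zero => simp
  | mul a b _ _ ha hb => rw [map_mul, map_mul, ha, hb]
  | smul c a _ ha => rw [map_smul, map_smul, ha]
  | star a _ ha => rw [map_star, map_star, ha]

end Limits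

section Levels

variable {V G B : Type*} [NonUnitalCStarAlgebra B] {r s : G → V} {Q : V → B} {T : G → B}
  [TopologicalSpace G] [DiscreteTopology G]

/-- The value on `f` of the homomorphism obtained by sampling `f` once on each cylinder set `Z(μ)`
with `r μ = v` and `|μ| = n`. -/
def level (hrow : ∀ v : V, (r ⁻¹' {v}).Finite) (Q : V → B) (T : G → B) (b : V → InfPath r s) :
    ℕ → V → C₀(InfPath r s, ℂ) → B
  | 0, v, f => f (b v) • Q v
  | n + 1, v, f =>
    ∑ e ∈ (hrow v).toFinset, T e * level hrow Q T b n (s e) (pull r s e f) * star (T e)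

variable (hrow : ∀ v : V, (r ⁻¹' {v}).Finite) (b : V → InfPath r s)

lemma level_add (n : ℕ) (v : V) (f g : C₀(InfPath r s, ℂ)) :
    level hrow Q T b n v (f + g) = level hrow Q T b n v f + level hrow Q T b n v g := by
  induction n generalizing v f g with
  | zero => simp [level, add_smul]
  | succ n ih => simp [level, ih, mul_add, add_mul, Finset.sum_add_distrib]

lemma level_smul (n : ℕ) (v : V) (c : ℂ) (f : C₀(InfPath r s, ℂ)) :
    level hrow Q T b n v (c • f) = c • level hrow Q T b n v f := by
  induction n generalizing v f with
  | zero => simp [level, mul_smul]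
  | succ n ih =>
    simp [level, map_smul, ih, Finset.smul_sum, mul_smul_comm, smul_mul_assoc]

lemma level_zero (n : ℕ) (v : V) : level hrow Q T b n v 0 = 0 := by
  simpa using level_smul (Q := Q) (T := T) hrow b n v 0 0

lemma level_eq_zero (hb : ∀ v, b v ∈ cylV r s v) (n : ℕ) (v : V) {f : C₀(InfPath r s, ℂ)}
    (hf : ∀ z ∈ cylV r s v, f z = 0) : level hrow Q T b n v f = 0 := by
  cases n with
  | zero => simp [level, hf _ (hb v)]
  | succ n =>
    refine Finset.sum_eq_zero fun e he => ?_
    have : pull r s e f = 0 := by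
      ext w
      by_cases h : s e = r (w.1 0)
      · rw [pull_apply_of_eq f h]
        exact hf _ (show r e = v by simpa using he)
      · exact pull_apply_of_ne f h
    rw [this, level_zero, mul_zero, zero_mul]

section

variable (hCK : IsCKFamily r s Q T)
include hCK

lemma level_star (n : ℕ) (v : V) (f : C₀(InfPath r s, ℂ)) :
    level hrow Q T b n v (star f) = star (level hrow Q T b n v f) := by
  induction n generalizing v f with
  | zero => simp [level, (hCK.proj v).1]
  | succ n ih => simp [level, map_star, ih, mul_assoc]

lemma vertex_mul_level (n : ℕ) (v : V) (f : C₀(InfPath r s, ℂ)) :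
    Q v * level hrow Q T b n v f = level hrow Q T b n v f := by
  cases n with
  | zero => simp [level, mul_smul_comm, (hCK.proj v).2]
  | succ n =>
    rw [level, Finset.mul_sum]
    refine Finset.sum_congr rfl fun e he => ?_
    obtain rfl : r e = v := by simpa using he
    rw [← mul_assoc, ← mul_assoc, hCK.range_mul hrow]

lemma level_mul (n : ℕ) (v : V) (f g : C₀(InfPath r s, ℂ)) :
    level hrow Q T b n v (f * g) = level hrow Q T b n v f * level hrow Q T b n v g := by
  induction n generalizing v f g with
  | zero => simp [level, mul_smul_comm, smul_mul_assoc, (hCK.proj v).2, smul_smul, mul_comm]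
  | succ n ih =>
    simp only [level]
    rw [Finset.sum_mul_sum]
    refine Finset.sum_congr rfl fun e he => ?_
    rw [Finset.sum_eq_single_of_mem e he]
    · rw [map_mul, ih, ← mul_assoc (_ * _), mul_assoc _ (star (T e)), ← mul_assoc (star (T e)),
        hCK.srce, vertex_mul_level hrow b hCK]
      simp only [mul_assoc]
    · intro e' _ hne
      rw [← mul_assoc (_ * _), mul_assoc _ (star (T e)), ← mul_assoc (star (T e)),
        hCK.star_mul_of_ne hrow hne.symm, zero_mul, mul_zero, zero_mul]

lemma level_mul_of_ne (n : ℕ) {v w : V} (hvw : v ≠ w) (f g : C₀(InfPath r s, ℂ)) :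
    level hrow Q T b n v f * level hrow Q T b n w g = 0 := by
  have h : level hrow Q T b n v f * Q v = level hrow Q T b n v f := by
    have := congrArg star (vertex_mul_level hrow b hCK n v (star f))
    rwa [star_mul, (hCK.proj v).1, ← level_star hrow b hCK, star_star] at this
  rw [← h, ← vertex_mul_level hrow b hCK n w g, mul_assoc, ← mul_assoc (Q v), hCK.orth v w hvw,
    zero_mul, mul_zero]

/-- The `*`-homomorphism obtained by sampling on all cylinder sets `Z(μ)` with `r μ ∈ F` and
`|μ| = n`. -/
def sampling (i : ℕ × Finset V) : C₀(InfPath r s, ℂ) →⋆ₙₐ[ℂ] B where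
  toFun f := ∑ v ∈ i.2, level hrow Q T b i.1 v f
  map_smul' c f := by simp [level_smul, Finset.smul_sum]
  map_zero' := by simp [level_zero]
  map_add' f g := by simp [level_add, Finset.sum_add_distrib]
  map_mul' f g := by
    rw [Finset.sum_mul_sum]
    refine Finset.sum_congr rfl fun v hv => ?_
    rw [Finset.sum_eq_single_of_mem v hv fun w _ hne =>
      level_mul_of_ne hrow b hCK _ hne.symm f g, level_mul hrow b hCK]
  map_star' f := by simp [level_star hrow b hCK]

lemma level_cylV (hb : ∀ v, b v ∈ cylV r s v) (n : ℕ) (v : V) {f : C₀(InfPath r s, ℂ)}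
    (hf : ∀ z, f z = (cylV r s v).indicator (fun _ => (1 : ℂ)) z) :
    level hrow Q T b n v f = Q v := by
  induction n generalizing v f with
  | zero => simp [level, hf, hb]
  | succ n ih =>
    rw [level, hCK.vertex_eq_sum hrow]
    refine Finset.sum_congr rfl fun e he => ?_
    rw [ih (s e), hCK.mul_source]
    intro w
    by_cases h : s e = r (w.1 0)
    · rw [pull_apply_of_eq f h, hf, Set.indicator_of_mem (show w ∈ cylV r s (s e) from h.symm)]
      exact Set.indicator_of_mem (s := cylV r s v) (show r e = v by simpa using he) _
    · rw [pull_apply_of_ne f h,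
        Set.indicator_of_notMem (show w ∉ cylV r s (s e) from fun h' => h (Eq.symm h'))]

omit hCK [NonUnitalCStarAlgebra B] [TopologicalSpace G] [DiscreteTopology G] in
lemma lprod_mul {M : Type*} [Semigroup M] (a b : M) (l : List M) :
    lprod (a * b) l = a * lprod b l := by
  induction l generalizing b with
  | nil => rfl
  | cons c l ih => rw [lprod, lprod, mul_assoc, ih]

omit [TopologicalSpace G] [DiscreteTopology G] in
lemma lprod_eq_mul_tPath (e : G) (μ : List G) :
    lprod (T e) (μ.map T) = T e * tPath Q T (s e) μ := by
  cases μ with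
  | nil => exact (hCK.mul_source e).symm
  | cons f μ => exact lprod_mul _ _ _

omit hCK in
lemma level_succ_of_support {e : G} {n : ℕ} (hn : 0 < n) {f : C₀(InfPath r s, ℂ)}
    (hf : ∀ z, z.1 0 ≠ e → f z = 0) :
    level hrow Q T b n (r e) f =
      T e * level hrow Q T b (n - 1) (s e) (pull r s e f) * star (T e) := by
  obtain ⟨n, rfl⟩ := Nat.exists_eq_succ_of_ne_zero hn.ne'
  rw [level]
  refine Finset.sum_eq_single_of_mem e (by simp) fun e' _ hne => ?_
  have : pull r s e' f = 0 := by
    ext w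
    by_cases h : s e' = r (w.1 0)
    · rw [pull_apply_of_eq f h]
      exact hf _ hne
    · exact pull_apply_of_ne f h
  rw [this, level_zero, mul_zero, zero_mul]

omit hCK [NonUnitalCStarAlgebra B] [TopologicalSpace G] [DiscreteTopology G] in
lemma indicator_cylP_of_ne {e : G} {μ : List G} {z : InfPath r s} (hz : z.1 0 ≠ e) :
    (cylP r s (e :: μ)).indicator (fun _ => (1 : ℂ)) z = 0 :=
  Set.indicator_of_notMem (fun h => hz (mem_cylP_cons.1 h).1) _

lemma level_cylP (hb : ∀ v, b v ∈ cylV r s v) {μ : List G} {e : G} (hμ : IsPathL r s (e :: μ))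
    {n : ℕ} (hn : μ.length < n) {f : C₀(InfPath r s, ℂ)}
    (hf : ∀ z, f z = (cylP r s (e :: μ)).indicator (fun _ => (1 : ℂ)) z) :
    level hrow Q T b n (r e) f =
      lprod (T e) (μ.map T) * star (lprod (T e) (μ.map T)) := by
  induction μ generalizing e n f with
  | nil =>
    rw [level_succ_of_support hrow b (by simpa using hn)
      fun z hz => (hf z).trans (indicator_cylP_of_ne hz),
      level_cylV hrow b hCK hb, lprod_eq_mul_tPath hCK]
    · simp [tPath, mul_assoc, (hCK.proj (s e)).1, hCK.source_mul_star]
    · intro w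
      by_cases h : s e = r (w.1 0)
      · rw [pull_apply_of_eq f h, hf, Set.indicator_of_mem (show w ∈ cylV r s (s e) from h.symm)]
        exact Set.indicator_of_mem (show InfPath.cons e w h ∈ cylP r s [e] from
          mem_cylP_cons.2 ⟨rfl, fun i hi => absurd hi (Nat.not_lt_zero i)⟩) _
      · rw [pull_apply_of_ne f h,
          Set.indicator_of_notMem (show w ∉ cylV r s (s e) from fun h' => h (Eq.symm h'))]
  | cons g μ ih =>
    have hg : s e = r g := hμ.rel
    have hn' : 0 < n := (Nat.zero_le _).trans_lt hn
    rw [level_succ_of_support hrow b hn' fun z hz => (hf z).trans (indicator_cylP_of_ne hz),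
      lprod_eq_mul_tPath hCK, hg,
      ih (List.IsChain.tail hμ) (by simp at hn; omega)]
    · simp [tPath, mul_assoc]
    · intro w
      by_cases h : s e = r (w.1 0)
      · rw [pull_apply_of_eq f h, hf]
        have : InfPath.cons e w h ∈ cylP r s (e :: g :: μ) ↔ w ∈ cylP r s (g :: μ) := by
          simp [mem_cylP_cons (e := e)]
        by_cases hw : w ∈ cylP r s (g :: μ)
        · rw [Set.indicator_of_mem hw, Set.indicator_of_mem (this.2 hw)]
        · rw [Set.indicator_of_notMem hw, Set.indicator_of_notMem fun h' => hw (this.1 h')]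
      · rw [pull_apply_of_ne f h, Set.indicator_of_notMem]
        exact fun h' => h (hg.trans (cylP_cons_subset g μ h').symm)

end

end Levels

section Representation

variable {V G B : Type*} [NonUnitalCStarAlgebra B] {r s : G → V} {Q : V → B} {T : G → B}
  [TopologicalSpace G] [DiscreteTopology G]

lemma star_mul_sampling_mul (hrow : ∀ v : V, (r ⁻¹' {v}).Finite) (hCK : IsCKFamily r s Q T)
    {b : V → InfPath r s} (hb : ∀ v, b v ∈ cylV r s v) {i : ℕ × Finset V} {e : G}
    (hr : r e ∈ i.2) (hs : s e ∈ i.2) (h : C₀(InfPath r s, ℂ)) :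
    star (T e) * sampling hrow b hCK (i.1 + 1, i.2) h * T e =
      sampling hrow b hCK i (pull r s e h) := by
  have h1 : sampling hrow b hCK i (pull r s e h) = level hrow Q T b i.1 (s e) (pull r s e h) := by
    refine Finset.sum_eq_single_of_mem (s e) hs fun v _ hne => level_eq_zero hrow b hb _ _ ?_
    exact fun z hz => pull_apply_of_ne h fun h' => hne (Eq.trans (Eq.symm hz) h'.symm)
  have h2 : ∀ f a, f ≠ e → star (T e) * (T f * a * star (T f)) * T e = 0 := fun f a hne => by
    rw [mul_assoc (T f), ← mul_assoc (star (T e)), hCK.star_mul_of_ne hrow hne.symm, zero_mul,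
      zero_mul]
  have h3 : star (T e) * level hrow Q T b (i.1 + 1) (r e) h * T e =
      level hrow Q T b i.1 (s e) (pull r s e h) := by
    rw [level, Finset.mul_sum, Finset.sum_mul,
      Finset.sum_eq_single_of_mem e (by simp) fun f _ hne => h2 f _ hne]
    have hQ := vertex_mul_level hrow b hCK i.1 (s e)
    have hQ' : level hrow Q T b i.1 (s e) (pull r s e h) * Q (s e) =
        level hrow Q T b i.1 (s e) (pull r s e h) := by
      have := congrArg star (hQ (star (pull r s e h)))
      rwa [star_mul, (hCK.proj _).1, ← level_star hrow b hCK, star_star] at this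
    rw [mul_assoc, mul_assoc, mul_assoc, hCK.srce, hQ', ← mul_assoc, hCK.srce, hQ]
  rw [h1, ← h3]
  change star (T e) * (∑ v ∈ i.2, level hrow Q T b (i.1 + 1) v h) * T e = _
  rw [Finset.mul_sum, Finset.sum_mul]
  refine Finset.sum_eq_single_of_mem (r e) hr fun v _ hne => ?_
  rw [level, Finset.mul_sum, Finset.sum_mul]
  refine Finset.sum_eq_zero fun f hf => h2 f _ ?_
  rintro rfl
  exact hne (by simpa using (show r f = v by simpa using hf).symm)

/-- The data on `π : C₀(E^∞) → B` from which a covariant representation is built. -/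
structure IsCKHom (Q : V → B) (T : G → B) (π : C₀(InfPath r s, ℂ) →⋆ₙₐ[ℂ] B) : Prop where
  vertex : ∀ (v : V) (f : C₀(InfPath r s, ℂ)),
    (∀ z, f z = (cylV r s v).indicator (fun _ => (1 : ℂ)) z) → π f = Q v
  path : ∀ (e : G) (μ : List G), IsPathL r s (e :: μ) → ∀ f : C₀(InfPath r s, ℂ),
    (∀ z, f z = (cylP r s (e :: μ)).indicator (fun _ => (1 : ℂ)) z) →
      π f = lprod (T e) (μ.map T) * star (lprod (T e) (μ.map T))
  compress : ∀ (e : G) (h : C₀(InfPath r s, ℂ)), star (T e) * π h * T e = π (pull r s e h)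

lemma exists_isCKHom (hrow : ∀ v : V, (r ⁻¹' {v}).Finite)
    (hsrc : ∀ v : V, (r ⁻¹' {v}).Nonempty) (hCK : IsCKFamily r s Q T) :
    ∃ π : C₀(InfPath r s, ℂ) →⋆ₙₐ[ℂ] B, IsCKHom Q T π := by
  classical
  choose b hb using exists_mem_cylV (s := s) hsrc
  have hev : ∀ (n : ℕ) (F : Finset V), ∀ᶠ i : ℕ × Finset V in Filter.atTop, n ≤ i.1 ∧ F ⊆ i.2 :=
    fun n F => Filter.eventually_ge_atTop (n, F)
  have hV : ∀ (v : V) (f : C₀(InfPath r s, ℂ)),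
      (∀ z, f z = (cylV r s v).indicator (fun _ => (1 : ℂ)) z) →
      Filter.Tendsto (fun i => sampling hrow b hCK i f) Filter.atTop (nhds (Q v)) := by
    intro v f hf
    refine tendsto_const_nhds.congr' ?_
    filter_upwards [hev 0 {v}] with i hi
    rw [← level_cylV hrow b hCK hb i.1 v hf]
    change _ = ∑ w ∈ i.2, level hrow Q T b i.1 w f
    symm
    refine Finset.sum_eq_single_of_mem v (by simpa using hi.2) fun w _ hne =>
      level_eq_zero hrow b hb _ _ fun z hz => ?_
    exact (hf z).trans (Set.indicator_of_notMem
      (show z ∉ cylV r s v from fun h => hne (Eq.trans (Eq.symm hz) h)) _)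
  have hP : ∀ (e : G) (μ : List G), IsPathL r s (e :: μ) → ∀ f : C₀(InfPath r s, ℂ),
      (∀ z, f z = (cylP r s (e :: μ)).indicator (fun _ => (1 : ℂ)) z) →
      Filter.Tendsto (fun i => sampling hrow b hCK i f) Filter.atTop
        (nhds (lprod (T e) (μ.map T) * star (lprod (T e) (μ.map T)))) := by
    intro e μ hμ f hf
    refine tendsto_const_nhds.congr' ?_
    filter_upwards [hev (μ.length + 1) {r e}] with i hi
    rw [← level_cylP hrow b hCK hb hμ (Nat.lt_of_succ_le hi.1) hf]
    change _ = ∑ w ∈ i.2, level hrow Q T b i.1 w f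
    symm
    refine Finset.sum_eq_single_of_mem (r e) (by simpa using hi.2) fun w _ hne =>
      level_eq_zero hrow b hb _ _ fun z hz => ?_
    rw [hf, Set.indicator_of_notMem fun h =>
      hne (Eq.trans (Eq.symm hz) (cylP_cons_subset e μ h))]
  obtain ⟨π, hπ⟩ := exists_limit_starHom (l := Filter.atTop) (sampling hrow b hCK) fun f => by
    refine exists_tendsto_of_mem_closure _ (fun a ha => ?_)
      (closure_adjoin_cylFns hrow ▸ Set.mem_univ f)
    induction ha using NonUnitalStarAlgebra.adjoin_induction with
    | mem a ha =>
      obtain ⟨e, μ, hμ, ha⟩ := ha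
      exact ⟨_, hP e μ hμ a ha⟩
    | add a b _ _ ha hb =>
      obtain ⟨a', ha⟩ := ha
      obtain ⟨b', hb⟩ := hb
      exact ⟨_, by simpa using ha.add hb⟩
    | zero => exact ⟨0, by simp⟩
    | mul a b _ _ ha hb =>
      obtain ⟨a', ha⟩ := ha
      obtain ⟨b', hb⟩ := hb
      exact ⟨_, by simpa using ha.mul hb⟩
    | smul c a _ ha =>
      obtain ⟨a', ha⟩ := ha
      exact ⟨_, by simpa using ha.const_smul c⟩
    | star a _ ha =>
      obtain ⟨a', ha⟩ := ha
      exact ⟨_, by simpa [map_star] using ha.star⟩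
  refine ⟨π, fun v f hf => tendsto_nhds_unique (hπ f) (hV v f hf),
    fun e μ hμ f hf => tendsto_nhds_unique (hπ f) (hP e μ hμ f hf), fun e h => ?_⟩
  have hshift : Filter.Tendsto (fun i : ℕ × Finset V => (i.1 + 1, i.2)) Filter.atTop
      Filter.atTop :=
    Filter.tendsto_atTop_mono (fun i => ⟨Nat.le_succ _, le_rfl⟩) Filter.tendsto_id
  have h1 := (((hπ h).comp hshift).const_mul (star (T e))).mul_const (T e)
  refine tendsto_nhds_unique (h1.congr' ?_) (hπ (pull r s e h))
  filter_upwards [hev 0 {r e, s e}] with i hi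
  exact star_mul_sampling_mul hrow hCK hb (hi.2 (by simp)) (hi.2 (by simp)) h

/-- The inclusion of `C_c` into `C₀`. -/
def compactToZero (X : Type*) [TopologicalSpace X] : C_c(X, ℂ) →ₗ[ℂ] C₀(X, ℂ) where
  toFun x := ⟨x.toContinuousMap, zero_at_infty x⟩
  map_add' _ _ := rfl
  map_smul' _ _ := rfl

/-- The characteristic function of a compact open set, as an element of `C_c`. -/
def chiC {X : Type*} [TopologicalSpace X] [T2Space X] (U : Set X) (ho : IsClopen U) (hc : IsCompact U) :
    C_c(X, ℂ) where
  toContinuousMap := (chi U ho hc).toContinuousMap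
  hasCompactSupport' := HasCompactSupport.intro hc fun _ hx => chi_of_notMem ho hc hx

lemma chiC_of_mem {X : Type*} [TopologicalSpace X] [T2Space X] {U : Set X} (ho : IsClopen U)
    (hc : IsCompact U) {x : X} (h : x ∈ U) : chiC U ho hc x = 1 := chi_of_mem ho hc h

lemma chiC_of_notMem {X : Type*} [TopologicalSpace X] [T2Space X] {U : Set X} (ho : IsClopen U)
    (hc : IsCompact U) {x : X} (h : x ∉ U) : chiC U ho hc x = 0 := chi_of_notMem ho hc h

/-- The finite set of initial edges of the paths in the support of `x`. -/
def heads (x : C_c(InfPath r s, ℂ)) : Finset G :=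
  (isCompact_iff_finite.1
    (x.hasCompactSupport.isCompact.image (InfPath.continuous_apply 0))).toFinset

lemma mem_heads {x : C_c(InfPath r s, ℂ)} {z : InfPath r s} (hz : x z ≠ 0) :
    z.1 0 ∈ heads x := by
  simpa [heads] using ⟨z, subset_tsupport _ hz, rfl⟩

omit [TopologicalSpace G] [DiscreteTopology G] in
lemma mem_cylP_singleton {e : G} {z : InfPath r s} : z ∈ cylP r s [e] ↔ z.1 0 = e :=
  mem_cylP_cons.trans ⟨And.left, fun h => ⟨h, fun _ hi => absurd hi (Nat.not_lt_zero _)⟩⟩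

/-- A linear map that is `C₀`-linear over `π` and maps `χ_{Z(e)}` to `T e` is determined by `π`. -/
lemma eq_sum_of_act (hrow : ∀ v : V, (r ⁻¹' {v}).Finite)
    {ψ : C_c(InfPath r s, ℂ) →ₗ[ℂ] B} {π : C₀(InfPath r s, ℂ) →⋆ₙₐ[ℂ] B}
    (hact : ∀ (f : C₀(InfPath r s, ℂ)) (x y : C_c(InfPath r s, ℂ)),
      (∀ z, y z = f z * x z) → ψ y = π f * ψ x)
    (hψ : ∀ e, ψ (chiC (cylP r s [e]) (isClopen_cylP _) (isCompact_cylP hrow e [])) = T e)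
    (x : C_c(InfPath r s, ℂ)) : ψ x = ∑ e ∈ heads x, π (compactToZero _ x) * T e := by
  have hx : x = ∑ e ∈ heads x,
      x * chiC (cylP r s [e]) (isClopen_cylP _) (isCompact_cylP hrow e []) := by
    ext z
    rw [CompactlySupportedContinuousMap.sum_apply]
    by_cases hz : x z = 0
    · simp [hz]
    · rw [Finset.sum_eq_single_of_mem _ (mem_heads hz)]
      · simp [chiC_of_mem (isClopen_cylP _) (isCompact_cylP hrow _ []) (mem_cylP_singleton.2 rfl)]
      · intro e _ hne
        simp [chiC_of_notMem (isClopen_cylP _) (isCompact_cylP hrow e [])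
          (fun h => hne (mem_cylP_singleton.1 h).symm)]
  conv_lhs => rw [hx]
  rw [map_sum]
  refine Finset.sum_congr rfl fun e _ => ?_
  rw [hact (compactToZero _ x) _ _ fun z => rfl, hψ]

end Representation

section Construction

variable {V G B : Type*} [NonUnitalCStarAlgebra B] {r s : G → V} {Q : V → B} {T : G → B}
  [TopologicalSpace G] [DiscreteTopology G]

section

variable {π : C₀(InfPath r s, ℂ) →⋆ₙₐ[ℂ] B} (hrow : ∀ v : V, (r ⁻¹' {v}).Finite)
  (hCK : IsCKFamily r s Q T) (hπ : IsCKHom Q T π)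
include hrow hCK hπ

omit hCK in
lemma IsCKHom.chi_edge (e : G) :
    π (chi (cylP r s [e]) (isClopen_cylP _) (isCompact_cylP hrow e [])) = T e * star (T e) :=
  hπ.path e [] (List.isChain_singleton e) _ fun _ => rfl

lemma IsCKHom.chi_mul_edge (e : G) :
    π (chi (cylP r s [e]) (isClopen_cylP _) (isCompact_cylP hrow e [])) * T e = T e := by
  rw [hπ.chi_edge hrow, mul_assoc, hCK.srce, hCK.mul_source]

lemma IsCKHom.mul_edge_congr {f g : C₀(InfPath r s, ℂ)} {e : G}
    (h : ∀ z, z.1 0 = e → f z = g z) : π f * T e = π g * T e := by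
  rw [← hπ.chi_mul_edge hrow hCK e, ← mul_assoc, ← mul_assoc, ← map_mul, ← map_mul]
  congr 2
  ext z
  by_cases hz : z.1 0 = e
  · simp [h z hz]
  · simp [chi_of_notMem (isClopen_cylP _) (isCompact_cylP hrow e [])
      (fun h' => hz (mem_cylP_singleton.1 h'))]

lemma IsCKHom.mul_edge_eq_zero {f : C₀(InfPath r s, ℂ)} {e : G}
    (h : ∀ z, z.1 0 = e → f z = 0) : π f * T e = 0 := by
  simpa using hπ.mul_edge_congr hrow hCK (g := 0) h

lemma IsCKHom.star_edge_mul_edge_of_ne (f : C₀(InfPath r s, ℂ)) {d e : G} (h : d ≠ e) :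
    star (T d) * π f * T e = 0 := by
  rw [← hπ.chi_mul_edge hrow hCK e, mul_assoc, ← mul_assoc (π f), ← map_mul, mul_comm f, map_mul,
    hπ.chi_edge hrow]
  simp only [← mul_assoc]
  rw [hCK.star_mul_of_ne hrow h]
  simp

end

/-- The linear map `ψ` with `ψ (x) = ∑ₑ π (x) T e`. -/
def edgeMap (T : G → B) (π : C₀(InfPath r s, ℂ) →⋆ₙₐ[ℂ] B)
    (h0 : ∀ (f : C₀(InfPath r s, ℂ)) (e : G), (∀ z, z.1 0 = e → f z = 0) → π f * T e = 0) :
    C_c(InfPath r s, ℂ) →ₗ[ℂ] B :=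
  have hF : ∀ x : C_c(InfPath r s, ℂ),
      (Function.support fun e => π (compactToZero _ x) * T e).Finite := fun x =>
    (heads x).finite_toSet.subset fun e he => by
      by_contra hx
      refine he (h0 _ _ fun z hz => ?_)
      by_contra hxz
      exact hx (hz ▸ mem_heads hxz)
  { toFun x := ∑ᶠ e, π (compactToZero _ x) * T e
    map_add' x y := by
      rw [← finsum_add_distrib (hF x) (hF y)]
      simp [add_mul]
    map_smul' c x := by
      rw [RingHom.id_apply, smul_finsum' c (hF x)]
      simp [smul_mul_assoc] }

section

variable {π : C₀(InfPath r s, ℂ) →⋆ₙₐ[ℂ] B} (hrow : ∀ v : V, (r ⁻¹' {v}).Finite)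
  (hCK : IsCKFamily r s Q T) (hπ : IsCKHom Q T π)
include hrow hCK hπ

lemma edgeMap_eq_sum (x : C_c(InfPath r s, ℂ)) {F : Finset G} (hF : heads x ⊆ F) :
    edgeMap T π (fun _ _ h => hπ.mul_edge_eq_zero hrow hCK h) x =
      ∑ e ∈ F, π (compactToZero _ x) * T e := by
  refine finsum_eq_sum_of_support_subset _ fun e he => hF ?_
  by_contra hx
  refine he (hπ.mul_edge_eq_zero hrow hCK fun z hz => ?_)
  by_contra hxz
  exact hx (hz ▸ mem_heads hxz)

lemma edgeMap_of_head {x : C_c(InfPath r s, ℂ)} {e : G} (hx : ∀ z, z.1 0 ≠ e → x z = 0) :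
    edgeMap T π (fun _ _ h => hπ.mul_edge_eq_zero hrow hCK h) x = π (compactToZero _ x) * T e := by
  refine finsum_eq_single _ e fun d hd => hπ.mul_edge_eq_zero hrow hCK fun z hz => ?_
  exact hx z (hz ▸ hd)

lemma star_edgeMap_mul_edgeMap (x y : C_c(InfPath r s, ℂ)) :
    ∃ F : Finset G, heads x ⊆ F ∧
      star (edgeMap T π (fun _ _ h => hπ.mul_edge_eq_zero hrow hCK h) x) *
        edgeMap T π (fun _ _ h => hπ.mul_edge_eq_zero hrow hCK h) y =
        π (∑ e ∈ F, pull r s e (star (compactToZero _ x) * compactToZero _ y)) := by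
  classical
  refine ⟨heads x ∪ heads y, Finset.subset_union_left, ?_⟩
  rw [edgeMap_eq_sum hrow hCK hπ x Finset.subset_union_left,
    edgeMap_eq_sum hrow hCK hπ y Finset.subset_union_right, star_sum, Finset.sum_mul_sum, map_sum]
  refine Finset.sum_congr rfl fun e he => ?_
  have key : ∀ d, star (π (compactToZero _ x) * T e) * (π (compactToZero _ y) * T d) =
      star (T e) * π (star (compactToZero _ x) * compactToZero _ y) * T d := fun d => by
    simp [map_star, mul_assoc]
  rw [Finset.sum_eq_single_of_mem e he, key, hπ.compress]
  intro d _ hd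
  rw [key, hπ.star_edge_mul_edge_of_ne hrow hCK _ hd.symm]

lemma isToeplitzRep_edgeMap :
    IsToeplitzRep id (shift r s) (edgeMap T π fun _ _ h => hπ.mul_edge_eq_zero hrow hCK h) π where
  act f x y hy := by
    have : compactToZero _ y = f * compactToZero _ x := by ext z; exact hy z
    classical
    rw [edgeMap_eq_sum hrow hCK hπ x (Finset.subset_union_left (s₂ := heads y)),
      edgeMap_eq_sum hrow hCK hπ y (Finset.subset_union_right (s₁ := heads x)), this,
      Finset.mul_sum]
    simp [mul_assoc]
  inner x U _ hU hxU g hg hg0 := by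
    obtain ⟨F, hF, h⟩ := star_edgeMap_mul_edgeMap hrow hCK hπ x x
    rw [h]
    congr 1
    have hinj : ∀ z z', x z ≠ 0 → x z' ≠ 0 → shift r s z = shift r s z' → z = z' :=
      fun z z' hz hz' hzz => congrArg Subtype.val
        (hU.injective (a₁ := ⟨z, hxU (subset_tsupport _ hz)⟩)
          (a₂ := ⟨z', hxU (subset_tsupport _ hz')⟩) hzz)
    have hsum (w) : (∑ e ∈ F, pull r s e (star (compactToZero _ x) * compactToZero _ x)) w =
        ∑ e ∈ F, pull r s e (star (compactToZero _ x) * compactToZero _ x) w :=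
      map_sum (⟨⟨fun f => f w, rfl⟩, fun _ _ => rfl⟩ : C₀(InfPath r s, ℂ) →+ ℂ) _ F
    ext w
    rw [hsum]
    by_cases hw : w ∈ shift r s '' Function.support ⇑x
    · obtain ⟨z, hz, rfl⟩ := hw
      rw [hg z hz, Finset.sum_eq_single_of_mem _ (hF (mem_heads hz))]
      · rw [pull_apply_of_eq _ (z.2 0)]
        change _ = star (x (InfPath.cons _ (shift r s z) _)) * x (InfPath.cons _ (shift r s z) _)
        rw [InfPath.cons_shift]
        exact (RCLike.conj_mul _).symm
      · intro e _ hne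
        by_cases h : s e = r ((shift r s z).1 0)
        · rw [pull_apply_of_eq _ h]
          change star (x (InfPath.cons _ (shift r s z) _)) * x (InfPath.cons _ (shift r s z) _) = 0
          by_contra h0
          exact hne (congrArg (fun z => z.1 0) (hinj _ _ (right_ne_zero_of_mul h0) hz rfl))
        · exact pull_apply_of_ne _ h
    · rw [hg0 w hw]
      refine (Finset.sum_eq_zero fun e _ => ?_).symm
      by_cases h : s e = r (w.1 0)
      · rw [pull_apply_of_eq _ h]
        by_contra h0
        exact hw ⟨_, right_ne_zero_of_mul h0, shift_cons _ _ _⟩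
      · exact pull_apply_of_ne _ h
  orth x y Ux Uy _ _ _ _ hd hx hy := by
    obtain ⟨F, -, h⟩ := star_edgeMap_mul_edgeMap hrow hCK hπ x y
    have : star (compactToZero _ x) * compactToZero _ y = 0 := by
      ext z
      change star (x z) * y z = 0
      by_contra h0
      exact Set.disjoint_left.1 hd (hx (subset_tsupport _ (star_ne_zero.1 (left_ne_zero_of_mul h0))))
        (hy (subset_tsupport _ (right_ne_zero_of_mul h0)))
    rw [h, this]
    simp

omit hrow hπ [TopologicalSpace G] [DiscreteTopology G] in
lemma source_mul_tPath {e : G} {μ : List G} (hμ : IsPathL r s (e :: μ))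
    (hrow : ∀ v : V, (r ⁻¹' {v}).Finite) :
    Q (s e) * tPath Q T (s e) μ = tPath Q T (s e) μ := by
  cases μ with
  | nil => exact (hCK.proj _).2
  | cons g μ =>
    have hg : s e = r g := hμ.rel
    rw [tPath, ← lprod_mul, hg, hCK.range_mul hrow]

lemma edgeMap_cylP {e : G} {μ : List G} (hμ : IsPathL r s (e :: μ)) {x : C_c(InfPath r s, ℂ)}
    (hx : ∀ z, x z = (cylP r s (e :: μ)).indicator (fun _ => (1 : ℂ)) z) :
    edgeMap T π (fun _ _ h => hπ.mul_edge_eq_zero hrow hCK h) x =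
      lprod (T e) (μ.map T) * star (tPath Q T (s e) μ) := by
  rw [edgeMap_of_head hrow hCK hπ fun z hz => (hx z).trans (indicator_cylP_of_ne hz),
    hπ.path e μ hμ _ hx, mul_assoc]
  congr 1
  rw [lprod_eq_mul_tPath hCK, star_mul, mul_assoc, hCK.srce]
  have := congrArg star (source_mul_tPath hCK hμ hrow)
  rwa [star_mul, (hCK.proj _).1] at this

omit hrow hCK hπ [NonUnitalCStarAlgebra B] in
lemma Erg_id_eq_univ (hrow : ∀ v : V, (r ⁻¹' {v}).Finite) :
    Erg (id : InfPath r s → InfPath r s) = Set.univ := by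
  have h : Esce (id : InfPath r s → InfPath r s) = ∅ := by simp [Esce]
  refine Set.eq_univ_of_forall fun z => ⟨⟨cylV r s (r (z.1 0)),
    (isClopen_cylV _).isOpen.mem_nhds rfl, isCompact_cylV hrow _⟩, by simp [h]⟩

lemma isCovariant_edgeMap :
    IsCovariant id (shift r s) (edgeMap T π fun _ _ h => hπ.mul_edge_eq_zero hrow hCK h) π := by
  refine ⟨cylFns r s, ?_, ?_, ?_⟩
  · rintro f ⟨e, μ, -, hf⟩
    refine ⟨HasCompactSupport.intro (isCompact_cylP hrow e μ) fun z hz => ?_, fun z => ?_, ?_⟩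
    · rw [hf, Set.indicator_of_notMem hz]
    · rw [hf]
      exact Set.indicator_nonneg (fun _ _ => zero_le_one) z
    · rw [Erg_id_eq_univ hrow]
      exact Set.subset_univ _
  · rw [closure_adjoin_cylFns hrow, Erg_id_eq_univ hrow]
    simp
  · rintro f ⟨e, μ, hμ, hf⟩
    set U := cylP r s (e :: μ)
    have hU : IsClopen U := isClopen_cylP _
    have hUc : IsCompact U := isCompact_cylP hrow e μ
    have hfs : Function.support f = U := by
      ext z
      simp [hf]
    have hft : tsupport f = U := by rw [tsupport, hfs, hU.isClosed.closure_eq]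
    have hval : ∀ z, chiC U hU hUc z = U.indicator (fun _ => (1 : ℂ)) z := fun z => rfl
    refine ⟨{U}, fun _ => chiC U hU hUc, ?_, ?_, ?_, ?_, ?_⟩
    · simpa using ⟨hU.isOpen, isSSection_of_subset fun z hz => (mem_cylP_cons.1 hz).1⟩
    · simp [hft]
    · simp only [Finset.mem_singleton, forall_eq]
      refine ⟨fun z => ?_, fun z hz => ?_⟩
      · rw [hval]
        exact Set.indicator_nonneg (fun _ _ => zero_le_one) z
      · rw [hft]
        have : z ∈ U := by
          by_contra h
          exact hz (chiC_of_notMem hU hUc h)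
        exact ⟨this, this⟩
    · intro z
      by_cases h : z ∈ U <;> simp [hf, hval, h]
    · have hfc : f = compactToZero _ (chiC U hU hUc) := by
        ext z
        exact hf z
      rw [Finset.sum_singleton, edgeMap_of_head hrow hCK hπ (e := e)
        fun z hz => (hval z).trans (indicator_cylP_of_ne hz), ← hfc, star_mul, mul_assoc,
        ← mul_assoc (T e), ← hπ.chi_edge hrow, ← map_star, ← map_mul, ← map_mul]
      congr 1
      ext z
      by_cases hz : z ∈ U
      · have := chi_of_mem (isClopen_cylP _) (isCompact_cylP hrow e [])
          (mem_cylP_singleton.2 (mem_cylP_cons.1 hz).1)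
        simp [hf, hz, this]
      · simp [hf, hz]

end

end Construction

/-- Every Cuntz–Krieger `E`-family `{q_v}, {t_e}` in `B` arises from a unique
covariant Toeplitz representation `(ψ, π)` of `Ê = (E^∞, E^∞, id, σ)` with
`ψ(χ_{Z(eμ)}) = t_{eμ} t_μ*` and `π(χ_{Z(μ)}) = t_μ t_μ*`. -/
theorem statement19 {V G : Type*} [TopologicalSpace V] [TopologicalSpace G]
    [DiscreteTopology V] [DiscreteTopology G] [Countable V] [Countable G]
    (r s : G → V) (hrow : ∀ v : V, (r ⁻¹' {v}).Finite)
    (hsrc : ∀ v : V, (r ⁻¹' {v}).Nonempty)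
    {B : Type*} [NonUnitalCStarAlgebra B]
    (Q : V → B) (T : G → B) (hCK : IsCKFamily r s Q T) :
    ∃! p : (C_c(InfPath r s, ℂ) →ₗ[ℂ] B) × (C₀(InfPath r s, ℂ) →⋆ₙₐ[ℂ] B),
      IsToeplitzRep (id : InfPath r s → InfPath r s) (shift r s) p.1 p.2 ∧
      IsCovariant (id : InfPath r s → InfPath r s) (shift r s) p.1 p.2 ∧
      (∀ (e : G) (μ : List G), IsPathL r s (e :: μ) →
        ∀ x : C_c(InfPath r s, ℂ),
          (∀ z, x z = (cylP r s (e :: μ)).indicator (fun _ => (1 : ℂ)) z) →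
          p.1 x = lprod (T e) (μ.map T) * star (tPath Q T (s e) μ)) ∧
      (∀ v : V, ∀ f : C₀(InfPath r s, ℂ),
        (∀ z, f z = (cylV r s v).indicator (fun _ => (1 : ℂ)) z) →
        p.2 f = Q v * star (Q v)) ∧
      (∀ (e : G) (μ : List G), IsPathL r s (e :: μ) →
        ∀ f : C₀(InfPath r s, ℂ),
          (∀ z, f z = (cylP r s (e :: μ)).indicator (fun _ => (1 : ℂ)) z) →
          p.2 f = lprod (T e) (μ.map T) * star (lprod (T e) (μ.map T))) := by
  obtain ⟨π, hπ⟩ := exists_isCKHom hrow hsrc hCK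
  refine ⟨(edgeMap T π fun _ _ h => hπ.mul_edge_eq_zero hrow hCK h, π),
    ⟨isToeplitzRep_edgeMap hrow hCK hπ, isCovariant_edgeMap hrow hCK hπ,
      fun e μ hμ x hx => edgeMap_cylP hrow hCK hπ hμ hx,
      fun v f hf => by rw [(hCK.proj v).1, (hCK.proj v).2]; exact hπ.vertex v f hf, hπ.path⟩, ?_⟩
  have hedge : ∀ ψ : C_c(InfPath r s, ℂ) →ₗ[ℂ] B, (∀ (e : G) (μ : List G), IsPathL r s (e :: μ) →
        ∀ x : C_c(InfPath r s, ℂ),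
          (∀ z, x z = (cylP r s (e :: μ)).indicator (fun _ => (1 : ℂ)) z) →
          ψ x = lprod (T e) (μ.map T) * star (tPath Q T (s e) μ)) →
      ∀ e, ψ (chiC (cylP r s [e]) (isClopen_cylP _) (isCompact_cylP hrow e [])) = T e := by
    intro ψ h e
    rw [h e [] (List.isChain_singleton e) _ fun _ => rfl]
    change T e * star (Q (s e)) = T e
    rw [(hCK.proj _).1, hCK.mul_source]
  rintro ⟨ψ', π'⟩ ⟨hT, -, hψ, -, hP⟩
  have hππ : π' = π := by
    refine starHom_ext_of_closure_adjoin (closure_adjoin_cylFns hrow) ?_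
    rintro f ⟨e, μ, hμ, hf⟩
    exact (hP e μ hμ f hf).trans (hπ.path e μ hμ f hf).symm
  subst hππ
  refine Prod.ext (LinearMap.ext fun x => ?_) rfl
  exact (eq_sum_of_act hrow hT.act (hedge _ hψ) x).trans
    (edgeMap_eq_sum hrow hCK hπ x subset_rfl).symm

end TopGraphPaper
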